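/- Let k be a field, let 2 ≤ l ≤ n, let N ≥ l, and let γ_1, …, γ_N be linear forms in k[x_1,…,x_n] which are l-independent, i.e., any l of them are linearly independent. Let I_l be the ideal of k[x_1,…,x_n] generated by the monomials (γ_1⋯γ_N)/(γ_{i_1}⋯γ_{i_{l−1}}) over all sequences 1 ≤ i_1 < ⋯ < i_{l−1} ≤ N (the products of all γ_j with j outside {i_1,…,i_{l−1}}). Then the Krull dimension of k[x_1,…,x_n]/I_l equals n − l. -/

import Mathlib

open MvPolynomial Finset

/-- The linear form in `k[x_1,…,x_n]` corresponding to a covector with coefficients `w`. -/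
noncomputable def linForm {R : Type*} [CommSemiring R] {n : ℕ} (w : Fin n → R) :
    MvPolynomial (Fin n) R :=
  ∑ i, MvPolynomial.C (w i) * MvPolynomial.X i

/-- A family of vectors is `l`-independent if every `l` of them are linearly independent. -/
def LIndep {k : Type*} [Field k] {n N : ℕ} (γ : Fin N → Fin n → k) (l : ℕ) : Prop :=
  ∀ s : Finset (Fin N), s.card = l → LinearIndependent k (fun i : {x // x ∈ s} => γ i.1)

/-- The ideal `I_l` generated by the products of all `γ_j` with `j` outside a set of `l - 1`
indices. -/
noncomputable def omittingIdeal {k : Type*} [Field k] {n N : ℕ} (γ : Fin N → Fin n → k)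
    (l : ℕ) : Ideal (MvPolynomial (Fin n) k) :=
  Ideal.span {g | ∃ T : Finset (Fin N), T.card = l - 1 ∧ g = ∏ j ∈ Tᶜ, linForm (γ j)}

theorem linForm_eq_linearCombination {k : Type*} [Field k] {n : ℕ} (w : Fin n → k) :
    linForm w = Fintype.linearCombination k (X : Fin n → MvPolynomial (Fin n) k) w := by
  simp [linForm, Fintype.linearCombination_apply, smul_eq_C_mul]

theorem linForm_single {k : Type*} [Field k] {n : ℕ} (i : Fin n) :
    linForm (Pi.single i (1 : k)) = X i := by
  simp [linForm_eq_linearCombination]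

/-- The algebra map of polynomial rings induced by a linear map between the spaces of linear
forms. -/
noncomputable def linFormMap {k : Type*} [Field k] {n m : ℕ}
    (f : (Fin n → k) →ₗ[k] (Fin m → k)) : MvPolynomial (Fin n) k →ₐ[k] MvPolynomial (Fin m) k :=
  aeval fun i => linForm (f (Pi.single i 1))

theorem linFormMap_linForm {k : Type*} [Field k] {n m : ℕ}
    (f : (Fin n → k) →ₗ[k] (Fin m → k)) (w : Fin n → k) :
    linFormMap f (linForm w) = linForm (f w) := by
  have h : (linFormMap f).toLinearMap ∘ₗ Fintype.linearCombination k X =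
      Fintype.linearCombination k X ∘ₗ f := by
    refine LinearMap.pi_ext' fun i => LinearMap.ext_ring ?_
    simp [linFormMap, linForm_eq_linearCombination]
  simpa [linForm_eq_linearCombination] using LinearMap.congr_fun h w

theorem linForm_mem_of_mem_span {k : Type*} [Field k] {n : ℕ} {ι : Type*} (v : ι → Fin n → k)
    {w : Fin n → k} (hw : w ∈ Submodule.span k (Set.range v)) :
    linForm w ∈ Ideal.span (Set.range fun i => linForm (v i)) := by
  induction hw using Submodule.span_induction with
  | mem x hx =>
    obtain ⟨i, rfl⟩ := hx
    exact Ideal.subset_span ⟨i, rfl⟩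
  | zero => simp [linForm_eq_linearCombination]
  | add x y _ _ hx hy =>
    simpa [linForm_eq_linearCombination] using Ideal.add_mem _ hx hy
  | smul a x _ hx =>
    simpa [linForm_eq_linearCombination] using Submodule.smul_of_tower_mem _ a hx

/-- The quotient of a polynomial ring in `n` variables over a field by `c` linearly independent
linear forms has Krull dimension `n - c`. -/
theorem krullDim_quotient_span_linForm {k : Type*} [Field k] {n : ℕ} {ι : Type*} [Fintype ι]
    {v : ι → Fin n → k} (hv : LinearIndependent k v) :
    ringKrullDim (MvPolynomial (Fin n) k ⧸ Ideal.span (Set.range fun i => linForm (v i))) =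
      (n - Fintype.card ι : ℕ) := by
  set m := n - Fintype.card ι with hm
  let W := Submodule.span k (Set.range v)
  set J := Ideal.span (Set.range fun i => linForm (v i)) with hJ
  have hdim (d : ℕ) : ringKrullDim (MvPolynomial (Fin d) k) = d := by
    simp [MvPolynomial.ringKrullDim_of_isNoetherianRing]
  have hfin : Module.finrank k ((Fin n → k) ⧸ W) = Module.finrank k (Fin m → k) := by
    rw [Submodule.finrank_quotient, finrank_span_eq_card hv]
    simp [hm]
  let e := LinearEquiv.ofFinrankEq _ _ hfin
  let f : (Fin n → k) →ₗ[k] (Fin m → k) := e.toLinearMap ∘ₗ W.mkQ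
  have hf : Function.Surjective f := e.surjective.comp W.mkQ_surjective
  have hker (w : Fin n → k) : f w = 0 ↔ w ∈ W := by simp [f]
  obtain ⟨g, hg⟩ := f.exists_rightInverse_of_surjective (LinearMap.range_eq_top.2 hf)
  have hfg (u : Fin m → k) : f (g u) = u := LinearMap.congr_fun hg u
  rw [← hdim m]
  apply le_antisymm
  · refine ringKrullDim_le_of_surjective
      (((Ideal.Quotient.mkₐ k J).comp (linFormMap g)) : _ →+* _) ?_
    change Function.Surjective ((Ideal.Quotient.mkₐ k J).comp (linFormMap g))
    rw [← AlgHom.range_eq_top, eq_top_iff]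
    have hle : (Ideal.Quotient.mkₐ k J).range ≤
        ((Ideal.Quotient.mkₐ k J).comp (linFormMap g)).range := by
      rw [← Algebra.map_top, ← MvPolynomial.adjoin_range_X, AlgHom.map_adjoin,
        Algebra.adjoin_le_iff]
      rintro _ ⟨_, ⟨i, rfl⟩, rfl⟩
      refine ⟨linForm (f (Pi.single i 1)), ?_⟩
      change Ideal.Quotient.mk J (linFormMap g _) = Ideal.Quotient.mk J (X i)
      rw [linFormMap_linForm, ← linForm_single, Ideal.Quotient.eq]
      have hmem : g (f (Pi.single i 1)) - Pi.single i 1 ∈ W := by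
        rw [← hker, map_sub, hfg, sub_self]
      simpa [hJ, linForm_eq_linearCombination] using linForm_mem_of_mem_span v hmem
    refine le_trans ?_ hle
    rw [(AlgHom.range_eq_top _).2 (Ideal.Quotient.mkₐ_surjective k J)]
  · have hJker (a : MvPolynomial (Fin n) k) (ha : a ∈ J) : linFormMap f a = 0 := by
      have hle : J ≤ RingHom.ker (linFormMap f) := by
        rw [hJ, Ideal.span_le]
        rintro _ ⟨i, rfl⟩
        have h0 : f (v i) = 0 := (hker _).2 (Submodule.subset_span ⟨i, rfl⟩)
        rw [SetLike.mem_coe, RingHom.mem_ker, linFormMap_linForm, h0]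
        simp [linForm_eq_linearCombination]
      exact hle ha
    refine ringKrullDim_le_of_surjective
      (Ideal.Quotient.liftₐ J (linFormMap f) hJker : _ →+* _) ?_
    refine Ideal.Quotient.lift_surjective_of_surjective J hJker ?_
    change Function.Surjective (linFormMap f)
    rw [← AlgHom.range_eq_top, eq_top_iff, ← MvPolynomial.adjoin_range_X, Algebra.adjoin_le_iff]
    rintro _ ⟨j, rfl⟩
    exact ⟨linForm (g (Pi.single j 1)), by
      change linFormMap f _ = _
      rw [linFormMap_linForm, hfg, linForm_single]⟩

theorem omittingIdeal_le_span_linForm {k : Type*} [Field k] {n N l : ℕ} (hl : 0 < l)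
    (γ : Fin N → Fin n → k) {S : Finset (Fin N)} (hS : S.card = l) :
    omittingIdeal γ l ≤ Ideal.span (Set.range fun i : {x // x ∈ S} => linForm (γ i)) := by
  rw [omittingIdeal, Ideal.span_le]
  rintro _ ⟨T, hT, rfl⟩
  obtain ⟨i, hiS, hiT⟩ := Finset.exists_mem_notMem_of_card_lt_card (s := T) (t := S) (by omega)
  exact Ideal.mem_of_dvd _ (Finset.dvd_prod_of_mem _ (Finset.mem_compl.2 hiT))
    (Ideal.subset_span ⟨⟨i, hiS⟩, rfl⟩)

theorem exists_span_linForm_le_of_omittingIdeal_le {k : Type*} [Field k] {n N l : ℕ}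
    (hN : l ≤ N) (γ : Fin N → Fin n → k) {P : Ideal (MvPolynomial (Fin n) k)} [P.IsPrime]
    (hP : omittingIdeal γ l ≤ P) :
    ∃ S : Finset (Fin N), S.card = l ∧
      Ideal.span (Set.range fun i : {x // x ∈ S} => linForm (γ i)) ≤ P := by
  classical
  let A : Finset (Fin N) := {j | linForm (γ j) ∈ P}
  have hA : l ≤ A.card := by
    by_contra! hlt
    obtain ⟨T, hAT, hT⟩ := Finset.exists_superset_card_eq (s := A) (n := l - 1) (by omega)
      (by simp only [Fintype.card_fin]; omega)
    have hmem : ∏ j ∈ Tᶜ, linForm (γ j) ∈ P := hP (Ideal.subset_span ⟨T, hT, rfl⟩)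
    obtain ⟨j, hj, hjP⟩ := (Ideal.IsPrime.prod_mem_iff).1 hmem
    exact Finset.mem_compl.1 hj (hAT (by simpa [A] using hjP))
  obtain ⟨S, hSA, hS⟩ := Finset.exists_subset_card_eq hA
  refine ⟨S, hS, Ideal.span_le.2 ?_⟩
  rintro _ ⟨i, rfl⟩
  simpa [A] using hSA i.2

/-- To bound the dimension of `R ⧸ I` it suffices to bound the dimension of `R ⧸ J` for ideals `J`
such that every prime containing `I` contains one of them. -/
theorem ringKrullDim_quotient_le_of_forall_prime {R : Type*} [CommRing R] {I : Ideal R}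
    {d : WithBot ℕ∞}
    (h : ∀ P : Ideal R, P.IsPrime → I ≤ P → ∃ J ≤ P, ringKrullDim (R ⧸ J) ≤ d) :
    ringKrullDim (R ⧸ I) ≤ d := by
  rw [ringKrullDim_quotient]
  refine iSup_le fun p => ?_
  obtain ⟨J, hJ, hd⟩ := h p.head.1.asIdeal p.head.1.2 p.head.2
  refine le_trans ?_ hd
  rw [ringKrullDim_quotient]
  let q : LTSeries (PrimeSpectrum.zeroLocus (J : Set R)) :=
    { length := p.length
      toFun := fun i => ⟨(p i).1, fun _ hx => p.head_le i (hJ hx)⟩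
      step := fun i => p.step i }
  exact Order.LTSeries.length_le_krullDim q

/-- **Lemma 2.4, first assertion.** Let `k` be a field, `2 ≤ l ≤ n`, `N ≥ l`, and let
`γ_1, …, γ_N` be `l`-independent linear forms in `k[x_1,…,x_n]`.  Let `I_l` be the ideal
generated by the products `(γ_1⋯γ_N)/(γ_{i_1}⋯γ_{i_{l-1}})` over all
`1 ≤ i_1 < ⋯ < i_{l-1} ≤ N`.  Then the Krull dimension of `k[x_1,…,x_n]/I_l` equals
`n - l`. -/
theorem krullDim_quotient_omittingIdeal
    {k : Type*} [Field k] (n N l : ℕ) (hl2 : 2 ≤ l) (hln : l ≤ n) (hN : l ≤ N)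
    (γ : Fin N → Fin n → k) (hind : LIndep γ l) :
    ringKrullDim (MvPolynomial (Fin n) k ⧸ omittingIdeal γ l) = (n - l : ℕ) := by
  have hS {S : Finset (Fin N)} (hS : S.card = l) : ringKrullDim (MvPolynomial (Fin n) k ⧸
      Ideal.span (Set.range fun i : {x // x ∈ S} => linForm (γ i))) = (n - l : ℕ) := by
    rw [krullDim_quotient_span_linForm (hind S hS), Fintype.card_coe, hS]
  apply le_antisymm
  · refine ringKrullDim_quotient_le_of_forall_prime fun P _ hP => ?_
    obtain ⟨S, hcard, hSP⟩ := exists_span_linForm_le_of_omittingIdeal_le hN γ hP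
    exact ⟨_, hSP, (hS hcard).le⟩
  · obtain ⟨S, -, hcard⟩ := Finset.exists_subset_card_eq
      (s := (Finset.univ : Finset (Fin N))) (n := l) (by simpa using hN)
    rw [← hS hcard]
    exact ringKrullDim_le_of_surjective
      (Ideal.Quotient.factor (omittingIdeal_le_span_linForm (by omega) γ hcard))
      (Ideal.Quotient.factor_surjective _)
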